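/- arXiv:2108.08004 — 4 statements merged into one kernel-verified Lean document; each statement's English description precedes it below -/
import Mathlib

section
/- Let G be a digraph, f a discrete Morse function on G, and α an allowed elementary n-path on G. Then the following two conditions cannot both hold: (i) there exists an allowed elementary (n−1)-path β < α with f(β) = f(α); (ii) there exists an allowed elementary (n+1)-path γ > α with f(γ) = f(α). -/
open scoped BigOperators Classical

namespace PathMorse

/-- A digraph: an irreflexive edge relation on a vertex set. -/
structure Digraph (V : Type) where
  E : V → V → Prop
  irrefl : ∀ v, ¬ E v v

/-- A digraph is transitive if `u→v` and `v→w` imply `u→w`. -/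
def Digraph.Transitive {V : Type} (G : Digraph V) : Prop :=
  ∀ u v w, G.E u v → G.E v w → G.E u w

/-- `Gbar` is the transitive closure of `G`: the smallest transitive digraph containing `G`. -/
def IsTransClosure {V : Type} (G Gbar : Digraph V) : Prop :=
  Gbar.Transitive ∧ (∀ u v, G.E u v → Gbar.E u v) ∧
    ∀ H : Digraph V, H.Transitive → (∀ u v, G.E u v → H.E u v) →
      ∀ u v, Gbar.E u v → H.E u v

/-- An elementary `n`-path on `V`: a sequence of `n+1` vertices. -/
abbrev Path (V : Type) (n : ℕ) := Fin (n+1) → V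

/-- An elementary path is allowed on `G` if consecutive vertices are joined by directed edges. -/
def Allowed {V : Type} (G : Digraph V) {n : ℕ} (p : Path V n) : Prop :=
  ∀ i : Fin n, G.E (p i.castSucc) (p i.succ)

/-- The `i`-th face of a path: delete the `i`-th vertex. -/
def face {V : Type} {n : ℕ} (i : Fin (n+2)) (p : Path V (n+1)) : Path V n :=
  p ∘ i.succAbove

/-- `q` is obtained from `p` by deleting one vertex (the codimension-one relation `q < p`). -/
def IsFace {V : Type} {n : ℕ} (q : Path V n) (p : Path V (n+1)) : Prop :=
  ∃ i : Fin (n+2), face i p = q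

/-- Value of `f` on a path: sum of the values at the vertices. -/
def fPath {V : Type} (f : V → ℝ) {n : ℕ} (p : Path V n) : ℝ :=
  ∑ i, f (p i)

/-- There is an allowed coface `γ > p` with `f γ = f p`. -/
def HasEqualCoface {V : Type} (G : Digraph V) (f : V → ℝ) {n : ℕ} (p : Path V n) : Prop :=
  ∃ γ : Path V (n+1), Allowed G γ ∧ IsFace p γ ∧ fPath f γ = fPath f p

/-- There is an allowed face `β < p` with `f β = f p`. -/
def HasEqualFace {V : Type} (G : Digraph V) (f : V → ℝ) : (n : ℕ) → Path V n → Prop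
  | 0, _ => False
  | (n+1), p => ∃ β : Path V n, Allowed G β ∧ IsFace β p ∧ fPath f β = fPath f p

/-- A discrete Morse function on a digraph: nonnegative, and for each allowed elementary path
there is at most one allowed coface with the same value, and at most one allowed face with the
same value. -/
def IsMorse {V : Type} (G : Digraph V) (f : V → ℝ) : Prop :=
  (∀ v, 0 ≤ f v) ∧
  (∀ n (α : Path V n), Allowed G α →
    ∀ γ₁ γ₂ : Path V (n+1), Allowed G γ₁ → Allowed G γ₂ → IsFace α γ₁ → IsFace α γ₂ →
      fPath f γ₁ = fPath f α → fPath f γ₂ = fPath f α → γ₁ = γ₂) ∧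
  (∀ n (α : Path V (n+1)), Allowed G α →
    ∀ β₁ β₂ : Path V n, Allowed G β₁ → Allowed G β₂ → IsFace β₁ α → IsFace β₂ α →
      fPath f β₁ = fPath f α → fPath f β₂ = fPath f α → β₁ = β₂)

/-- A critical path: allowed, with no allowed coface of equal value, no allowed face of equal value. -/
def IsCritical {V : Type} (G : Digraph V) (f : V → ℝ) {n : ℕ} (p : Path V n) : Prop :=
  Allowed G p ∧ ¬ HasEqualCoface G f p ∧ ¬ HasEqualFace G f n p

/-- `n`-chains: the real vector space with (orthonormal) basis the elementary `n`-paths. -/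
abbrev Chain (V : Type) (n : ℕ) := Path V n → ℝ

variable {V : Type} [Fintype V] [DecidableEq V]

/-- The basis chain corresponding to an elementary path. -/
def unitP {n : ℕ} (p : Path V n) : Chain V n := Pi.single p 1

/-- The boundary operator on chains (as a bare function). -/
def boundaryFun {n : ℕ} (x : Chain V (n+1)) : Chain V n :=
  fun q => ∑ p : Path V (n+1), x p * ∑ i : Fin (n+2), ((-1:ℝ)^(i:ℕ)) * (if face i p = q then 1 else 0)

/-- The boundary operator `∂ = Σ (-1)^i d_i` as a linear map. -/
def boundary (V : Type) [Fintype V] [DecidableEq V] (n : ℕ) : Chain V (n+1) →ₗ[ℝ] Chain V n where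
  toFun := boundaryFun
  map_add' x y := by
    funext q
    simp [boundaryFun, add_mul, Finset.sum_add_distrib]
  map_smul' c x := by
    funext q
    simp [boundaryFun, Finset.mul_sum, mul_assoc]

/-- `P_n(G)`: the span of the allowed elementary `n`-paths. -/
def pSpan (G : Digraph V) (n : ℕ) : Submodule ℝ (Chain V n) :=
  Submodule.span ℝ {x : Chain V n | ∃ p : Path V n, Allowed G p ∧ x = unitP p}

/-- `Ω_n(G) = {x ∈ P_n(G) : ∂x ∈ P_{n-1}(G)}` (with `Ω_0 = P_0`). -/
def omega (G : Digraph V) : (n : ℕ) → Submodule ℝ (Chain V n)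
  | 0 => pSpan G 0
  | (n+1) => pSpan G (n+1) ⊓ (pSpan G n).comap (boundary V n)

/-- The discrete gradient vector field on a basis path: `V(α) = -⟨∂γ,α⟩ γ` if there is an
allowed coface `γ > α` with `f γ = f α`, and `0` otherwise. -/
noncomputable def gradFun (G : Digraph V) (f : V → ℝ) {n : ℕ} (α : Path V n) : Chain V (n+1) :=
  if h : Allowed G α ∧ ∃ γ : Path V (n+1), Allowed G γ ∧ IsFace α γ ∧ fPath f γ = fPath f α then
    (-(boundary V n (unitP h.2.choose) α)) • unitP h.2.choose
  else 0

/-- The discrete gradient vector field `V = grad f`, extended linearly to chains. -/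
noncomputable def grad (G : Digraph V) (f : V → ℝ) (n : ℕ) : Chain V n →ₗ[ℝ] Chain V (n+1) where
  toFun x := ∑ α : Path V n, x α • gradFun G f α
  map_add' x y := by simp [add_smul, Finset.sum_add_distrib]
  map_smul' c x := by simp [Finset.smul_sum, smul_smul]

/-- The composite `V∂` in degree `n` (zero in degree `0`). -/
noncomputable def vd (G : Digraph V) (f : V → ℝ) : (n : ℕ) → (Chain V n →ₗ[ℝ] Chain V n)
  | 0 => 0
  | (n+1) => (grad G f n).comp (boundary V n)

/-- The discrete gradient flow `Φ = Id + ∂V + V∂`. -/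
noncomputable def flow (G : Digraph V) (f : V → ℝ) (n : ℕ) : Chain V n →ₗ[ℝ] Chain V n :=
  LinearMap.id + (boundary V n).comp (grad G f n) + vd G f n

/-- `P_n^Φ(G) = {x ∈ P_n(G) : Φ x = x}`. -/
noncomputable def pPhi (G : Digraph V) (f : V → ℝ) (n : ℕ) : Submodule ℝ (Chain V n) :=
  pSpan G n ⊓ LinearMap.ker (flow G f n - LinearMap.id)

/-- The cycles of a chain complex of subspaces `C` with differentials `D`
(in degree `0`, everything is a cycle). -/
def cycles (C : ∀ n, Submodule ℝ (Chain V n)) (D : ∀ n, Chain V (n+1) →ₗ[ℝ] Chain V n) :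
    (m : ℕ) → Submodule ℝ (Chain V m)
  | 0 => C 0
  | (m+1) => C (m+1) ⊓ LinearMap.ker (D m)

/-- Homology of the chain complex `(C, D)`: cycles modulo boundaries coming from `C`. -/
abbrev Homology (C : ∀ n, Submodule ℝ (Chain V n)) (D : ∀ n, Chain V (n+1) →ₗ[ℝ] Chain V n)
    (m : ℕ) :=
  (cycles C D m) ⧸ (Submodule.comap (cycles C D m).subtype ((C (m+1)).map (D m)))

/-- The operator `e^{tf}` on chains. -/
noncomputable def expOp (f : V → ℝ) (t : ℝ) (n : ℕ) : Chain V n →ₗ[ℝ] Chain V n where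
  toFun x := fun p => Real.exp (t * fPath f p) * x p
  map_add' x y := by funext p; simp [mul_add]
  map_smul' c x := by funext p; simp; ring

/-- The deformed boundary `∂_t = e^{tf} ∂ e^{-tf}`. -/
noncomputable def dT (f : V → ℝ) (t : ℝ) (n : ℕ) : Chain V (n+1) →ₗ[ℝ] Chain V n :=
  (expOp f t n).comp ((boundary V n).comp (expOp f (-t) (n+1)))

/-- The span of the elementary `n`-paths that are critical in `Gbar` and allowed in `G`. -/
def critSpan (G Gbar : Digraph V) (f : V → ℝ) (n : ℕ) : Submodule ℝ (Chain V n) :=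
  Submodule.span ℝ {x : Chain V n | ∃ α : Path V n, IsCritical Gbar f α ∧ Allowed G α ∧ x = unitP α}

theorem val_succAbove {n : ℕ} (p : Fin (n + 1)) (i : Fin n) :
    (p.succAbove i).val = if i.val < p.val then i.val else i.val + 1 := by
  simp only [Fin.succAbove, Fin.lt_def, Fin.val_castSucc]
  split_ifs <;> simp

theorem Allowed.edge {V : Type} {G : Digraph V} {n : ℕ} {p : Path V n} (hp : Allowed G p)
    {a b : Fin (n + 1)} (h : b.val = a.val + 1) : G.E (p a) (p b) := by
  have ha : a.val < n := by omega
  have h₁ : (⟨a.val, ha⟩ : Fin n).castSucc = a := rfl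
  have h₂ : (⟨a.val, ha⟩ : Fin n).succ = b := Fin.ext h.symm
  have := hp ⟨a.val, ha⟩
  rwa [h₁, h₂] at this

theorem fPath_face_add {V : Type} (f : V → ℝ) {n : ℕ} (i : Fin (n + 2)) (p : Path V (n + 1)) :
    f (p i) + fPath f (face i p) = fPath f p :=
  (Fin.sum_univ_succAbove (fun x => f (p x)) i).symm

theorem fPath_face_eq_iff {V : Type} (f : V → ℝ) {n : ℕ} (i : Fin (n + 2))
    (p : Path V (n + 1)) : fPath f (face i p) = fPath f p ↔ f (p i) = 0 := by
  rw [← fPath_face_add f i p]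
  simp

/-- Deleting two different vertices of an allowed path gives two different faces. -/
theorem Allowed.face_injective {V : Type} {G : Digraph V} {n : ℕ} {p : Path V (n + 1)}
    (hp : Allowed G p) : Function.Injective fun i => face i p := by
  have key : ∀ i j : Fin (n + 2), i.val < j.val → face i p ≠ face j p := by
    intro i j hij h
    have hi : i.val < n + 1 := by omega
    have hE := hp.edge (a := j.succAbove ⟨i.val, hi⟩) (b := i.succAbove ⟨i.val, hi⟩)
      (by simp [val_succAbove, hij])
    have h' : p (i.succAbove ⟨i.val, hi⟩) = p (j.succAbove ⟨i.val, hi⟩) := congrFun h ⟨i.val, hi⟩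
    rw [h'] at hE
    exact G.irrefl _ hE
  intro i j h
  rcases lt_trichotomy i.val j.val with hij | hij | hij
  · exact absurd h (key i j hij)
  · exact Fin.ext hij
  · exact absurd h.symm (key j i hij)

/-- An allowed path has at most one zero of a discrete Morse function whose deletion leaves an
allowed path. -/
theorem IsMorse.eq_of_face_allowed {V : Type} {G : Digraph V} {f : V → ℝ} (hf : IsMorse G f)
    {n : ℕ} {p : Path V (n + 1)} (hp : Allowed G p) {i j : Fin (n + 2)}
    (hi : Allowed G (face i p)) (hj : Allowed G (face j p)) (hfi : f (p i) = 0)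
    (hfj : f (p j) = 0) : i = j :=
  hp.face_injective <| hf.2.2 n p hp _ _ hi hj ⟨i, rfl⟩ ⟨j, rfl⟩
    ((fPath_face_eq_iff f i p).2 hfi) ((fPath_face_eq_iff f j p).2 hfj)

/-- The zeros of a discrete Morse function are pairwise non-adjacent. -/
theorem IsMorse.not_edge_of_eq_zero {V : Type} {G : Digraph V} {f : V → ℝ} (hf : IsMorse G f)
    {u v : V} (hu : f u = 0) (hv : f v = 0) : ¬ G.E u v := by
  intro h
  have hp : Allowed G (![u, v] : Path V 1) := fun i => by
    obtain rfl : i = 0 := Subsingleton.elim _ _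
    exact h
  have : (0 : Fin 2) = 1 :=
    hf.eq_of_face_allowed hp (fun i => i.elim0) (fun i => i.elim0) hu hv
  exact absurd this (by decide)

/-- If deleting two vertices `j` and `j.succAbove i` in succession from an allowed path passes
through allowed paths only, and the two vertices are not neighbours, then they can also be
deleted in the opposite order. -/
theorem Allowed.face_succAbove {V : Type} {G : Digraph V} {n : ℕ} {p : Path V (n + 2)}
    (hp : Allowed G p) {j : Fin (n + 3)} {i : Fin (n + 2)}
    (hij : Allowed G (face i (face j p)))
    (h₁ : (j.succAbove i).val ≠ j.val + 1) (h₂ : j.val ≠ (j.succAbove i).val + 1) :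
    Allowed G (face (j.succAbove i) p) := by
  intro a
  show G.E (p ((j.succAbove i).succAbove a.castSucc)) (p ((j.succAbove i).succAbove a.succ))
  have hk := val_succAbove j i
  set k := j.succAbove i
  by_cases hak : a.val + 1 = k.val
  · have hc : i.val - 1 < n + 1 := by omega
    have hd : i.val < n + 1 := by split_ifs at hk <;> omega
    have hpos : 0 < i.val := by split_ifs at hk <;> omega
    have hE : G.E (p (j.succAbove (i.succAbove ⟨i.val - 1, hc⟩)))
        (p (j.succAbove (i.succAbove ⟨i.val, hd⟩))) :=
      hij.edge (a := ⟨i.val - 1, hc⟩) (b := ⟨i.val, hd⟩) (by simp; omega)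
    convert hE using 2 <;> apply Fin.ext <;>
      simp only [val_succAbove, Fin.val_castSucc, Fin.val_succ] <;> split_ifs at * <;> omega
  · apply hp.edge
    simp only [val_succAbove, Fin.val_castSucc, Fin.val_succ]
    split_ifs <;> omega

/-- For a discrete Morse function on a digraph, an allowed elementary path cannot
simultaneously have an allowed face of equal value and an allowed coface of equal value. -/
theorem stmt0 {V : Type} [Fintype V] [DecidableEq V] (G : Digraph V) (f : V → ℝ)
    (hf : IsMorse G f) (n : ℕ) (α : Path V n) (hα : Allowed G α) :
    ¬ (HasEqualFace G f n α ∧ HasEqualCoface G f α) := by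
  rintro ⟨hface, γ, hγ, ⟨j, rfl⟩, hγα⟩
  cases n with
  | zero => exact hface
  | succ m =>
    obtain ⟨_, hβ, ⟨i, rfl⟩, hβα⟩ := hface
    have hj : f (γ j) = 0 := (fPath_face_eq_iff f j γ).1 hγα.symm
    have hk : f (γ (j.succAbove i)) = 0 := (fPath_face_eq_iff f i (face j γ)).1 hβα
    have hα' : Allowed G (face (j.succAbove i) γ) :=
      hγ.face_succAbove hβ (fun h => hf.not_edge_of_eq_zero hj hk (hγ.edge h))
        (fun h => hf.not_edge_of_eq_zero hk hj (hγ.edge h))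
    exact Fin.succAbove_ne j i (hf.eq_of_face_allowed hγ hα' hα hk hj)

end PathMorse
end

section
/- Let G be a digraph and f a discrete Morse function on G. Then f is a discrete flat Witten-Morse function: for every allowed elementary n-path α on G, (1) for any two distinct allowed elementary (n+1)-paths γ₁ > α and γ₂ > α one has f(α) ≤ min{f(γ₁), f(γ₂)} and f(α) < (f(γ₁)+f(γ₂))/2, and (2) for any two distinct allowed elementary (n−1)-paths β₁ < α and β₂ < α one has f(α) ≥ max{f(β₁), f(β₂)} and f(α) > (f(β₁)+f(β₂))/2. -/
open scoped BigOperators Classical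

namespace PathMorse

variable {V : Type} [Fintype V] [DecidableEq V]

/-- Deleting a vertex does not increase a nonnegative vertex weight. -/
theorem IsFace.fPath_le {V : Type} {f : V → ℝ} (hf : ∀ v, 0 ≤ f v) {n : ℕ}
    {q : Path V n} {p : Path V (n+1)} (h : IsFace q p) : fPath f q ≤ fPath f p := by
  obtain ⟨i, rfl⟩ := h
  have hsum : fPath f p = f (p i) + fPath f (face i p) :=
    Fin.sum_univ_succAbove (fun j => f (p j)) i
  linarith [hf (p i)]

/-- A discrete Morse function on a digraph is a discrete flat Witten-Morse function. -/
theorem stmt1 {V : Type} [Fintype V] [DecidableEq V] (G : Digraph V) (f : V → ℝ)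
    (hf : IsMorse G f) :
    (∀ (n : ℕ) (α : Path V n), Allowed G α →
      ∀ γ₁ γ₂ : Path V (n+1), Allowed G γ₁ → Allowed G γ₂ →
        IsFace α γ₁ → IsFace α γ₂ → γ₁ ≠ γ₂ →
        fPath f α ≤ min (fPath f γ₁) (fPath f γ₂) ∧
          fPath f α < (fPath f γ₁ + fPath f γ₂) / 2) ∧
    (∀ (n : ℕ) (α : Path V (n+1)), Allowed G α →
      ∀ β₁ β₂ : Path V n, Allowed G β₁ → Allowed G β₂ →
        IsFace β₁ α → IsFace β₂ α → β₁ ≠ β₂ →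
        max (fPath f β₁) (fPath f β₂) ≤ fPath f α ∧
          (fPath f β₁ + fPath f β₂) / 2 < fPath f α) := by
  obtain ⟨hnonneg, hcoface, hface⟩ := hf
  refine ⟨fun n α hα γ₁ γ₂ hγ₁ hγ₂ hαγ₁ hαγ₂ hne => ?_,
    fun n α hα β₁ β₂ hβ₁ hβ₂ hβα₁ hβα₂ hne => ?_⟩
  · have h₁ := hαγ₁.fPath_le hnonneg
    have h₂ := hαγ₂.fPath_le hnonneg
    refine ⟨le_min h₁ h₂, lt_of_not_ge fun hge => hne ?_⟩
    exact hcoface n α hα γ₁ γ₂ hγ₁ hγ₂ hαγ₁ hαγ₂ (by linarith) (by linarith)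
  · have h₁ := hβα₁.fPath_le hnonneg
    have h₂ := hβα₂.fPath_le hnonneg
    refine ⟨max_le h₁ h₂, lt_of_not_ge fun hge => hne ?_⟩
    exact hface n α hα β₁ β₂ hβ₁ hβ₂ hβα₁ hβα₂ (by linarith) (by linarith)

end PathMorse
end

section
/- Let G be a digraph with transitive closure Ḡ, and let f, g be discrete Morse functions on G with the same zero-point set, S(f) = {v ∈ V : f(v)=0} = S(g). Suppose f and g are also discrete Morse functions on Ḡ (their extensions f̄, ḡ to Ḡ). Then f̄ and ḡ are equivalent on Ḡ, i.e., for every pair of allowed elementary paths α^(n) < γ^(n+1) on Ḡ one has f̄(α) < f̄(γ) if and only if ḡ(α) < ḡ(γ); consequently grad f̄ = grad ḡ as linear maps P_n(Ḡ) → P_{n+1}(Ḡ), the gradient flows of f̄ and ḡ on Ḡ coincide, and an allowed elementary path on Ḡ is critical for f̄ if and only if it is critical for ḡ. -/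
open scoped BigOperators Classical

namespace PathMorse

variable {V : Type} [Fintype V] [DecidableEq V]

theorem fPath_eq_face_add {W : Type} (f : W → ℝ) {n : ℕ} (γ : Path W (n+1)) (i : Fin (n+2)) :
    fPath f γ = f (γ i) + fPath f (face i γ) :=
  Fin.sum_univ_succAbove _ i

/-- Passing to a coface preserves the value exactly when the inserted vertex is a zero. -/
theorem fPath_eq_face_iff {W : Type} (f : W → ℝ) {n : ℕ} (γ : Path W (n+1)) (i : Fin (n+2)) :
    fPath f γ = fPath f (face i γ) ↔ f (γ i) = 0 := by
  rw [fPath_eq_face_add f γ i, add_eq_right]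

theorem fPath_face_lt_iff {W : Type} {f : W → ℝ} (hf : ∀ v, 0 ≤ f v) {n : ℕ}
    (γ : Path W (n+1)) (i : Fin (n+2)) :
    fPath f (face i γ) < fPath f γ ↔ f (γ i) ≠ 0 := by
  rw [fPath_eq_face_add f γ i, lt_add_iff_pos_left, (hf (γ i)).lt_iff_ne, ne_comm]

theorem fPath_eq_iff_of_isFace {W : Type} {f g : W → ℝ} (hzero : ∀ v, f v = 0 ↔ g v = 0)
    {n : ℕ} {α : Path W n} {γ : Path W (n+1)} (h : IsFace α γ) :
    fPath f γ = fPath f α ↔ fPath g γ = fPath g α := by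
  obtain ⟨i, rfl⟩ := h
  rw [fPath_eq_face_iff, fPath_eq_face_iff, hzero]

theorem fPath_lt_iff_of_isFace {W : Type} {f g : W → ℝ} (hf : ∀ v, 0 ≤ f v)
    (hg : ∀ v, 0 ≤ g v) (hzero : ∀ v, f v = 0 ↔ g v = 0)
    {n : ℕ} {α : Path W n} {γ : Path W (n+1)} (h : IsFace α γ) :
    fPath f α < fPath f γ ↔ fPath g α < fPath g γ := by
  obtain ⟨i, rfl⟩ := h
  rw [fPath_face_lt_iff hf, fPath_face_lt_iff hg, ne_eq, ne_eq, hzero]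

theorem hasEqualCoface_congr {W : Type} (G : Digraph W) {f g : W → ℝ}
    (hzero : ∀ v, f v = 0 ↔ g v = 0) {n : ℕ} (p : Path W n) :
    HasEqualCoface G f p ↔ HasEqualCoface G g p :=
  exists_congr fun _ => and_congr_right fun _ => and_congr_right fun h =>
    fPath_eq_iff_of_isFace hzero h

theorem hasEqualFace_congr {W : Type} (G : Digraph W) {f g : W → ℝ}
    (hzero : ∀ v, f v = 0 ↔ g v = 0) :
    ∀ (n : ℕ) (p : Path W n), HasEqualFace G f n p ↔ HasEqualFace G g n p
  | 0, _ => Iff.rfl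
  | _ + 1, _ => exists_congr fun _ => and_congr_right fun _ => and_congr_right fun h =>
      eq_comm.trans ((fPath_eq_iff_of_isFace hzero h).trans eq_comm)

theorem isCritical_congr {W : Type} (G : Digraph W) {f g : W → ℝ}
    (hzero : ∀ v, f v = 0 ↔ g v = 0) {n : ℕ} (p : Path W n) :
    IsCritical G f p ↔ IsCritical G g p := by
  rw [IsCritical, IsCritical, hasEqualCoface_congr G hzero, hasEqualFace_congr G hzero]

theorem gradFun_congr {W : Type} [Fintype W] [DecidableEq W] (G : Digraph W) {f g : W → ℝ}
    (hzero : ∀ v, f v = 0 ↔ g v = 0) {n : ℕ} (α : Path W n) :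
    gradFun G f α = gradFun G g α := by
  have h : (fun γ : Path W (n+1) => Allowed G γ ∧ IsFace α γ ∧ fPath f γ = fPath f α) =
      fun γ => Allowed G γ ∧ IsFace α γ ∧ fPath g γ = fPath g α :=
    funext fun γ => propext <| and_congr_right fun _ => and_congr_right fun h =>
      fPath_eq_iff_of_isFace hzero h
  unfold gradFun
  refine dite_congr (congrArg (fun P => Allowed G α ∧ Exists P) h) (fun _ => ?_) fun _ => rfl
  simp only [h]

theorem grad_congr {W : Type} [Fintype W] [DecidableEq W] (G : Digraph W) {f g : W → ℝ}
    (hzero : ∀ v, f v = 0 ↔ g v = 0) (n : ℕ) : grad G f n = grad G g n :=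
  LinearMap.ext fun x => Finset.sum_congr rfl fun α _ => by rw [gradFun_congr G hzero]

theorem vd_congr {W : Type} [Fintype W] [DecidableEq W] (G : Digraph W) {f g : W → ℝ}
    (hzero : ∀ v, f v = 0 ↔ g v = 0) : ∀ n : ℕ, vd G f n = vd G g n
  | 0 => rfl
  | n + 1 => by rw [vd, vd, grad_congr G hzero]

theorem flow_congr {W : Type} [Fintype W] [DecidableEq W] (G : Digraph W) {f g : W → ℝ}
    (hzero : ∀ v, f v = 0 ↔ g v = 0) (n : ℕ) : flow G f n = flow G g n := by
  rw [flow, flow, grad_congr G hzero, vd_congr G hzero]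

/-- Two discrete Morse functions on `G` with the same zero-point set, whose
extensions to the transitive closure are again discrete Morse functions, are equivalent on the
transitive closure and induce the same gradient vector field, the same gradient flow, and the
same critical paths. -/
theorem stmt2 {V : Type} [Fintype V] [DecidableEq V] (G Gbar : Digraph V)
    (hcl : IsTransClosure G Gbar) (f g : V → ℝ)
    (hf : IsMorse G f) (hg : IsMorse G g)
    (hzero : ∀ v, f v = 0 ↔ g v = 0)
    (hfbar : IsMorse Gbar f) (hgbar : IsMorse Gbar g) :
    (∀ (n : ℕ) (α : Path V n) (γ : Path V (n+1)),
        Allowed Gbar α → Allowed Gbar γ → IsFace α γ →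
        (fPath f α < fPath f γ ↔ fPath g α < fPath g γ)) ∧
    (∀ n, grad Gbar f n = grad Gbar g n) ∧
    (∀ n, flow Gbar f n = flow Gbar g n) ∧
    (∀ (n : ℕ) (p : Path V n), IsCritical Gbar f p ↔ IsCritical Gbar g p) :=
  ⟨fun _ _ _ _ _ h => fPath_lt_iff_of_isFace hfbar.1 hgbar.1 hzero h,
    grad_congr Gbar hzero, flow_congr Gbar hzero, fun _ => isCritical_congr Gbar hzero⟩

end PathMorse
end

section
/- Let G be a transitive digraph, f a discrete Morse function on G, and α = v₀v₁⋯v_n a critical allowed elementary n-path on G with n > 1. Then there is at most one index j, 0 ≤ j ≤ n, such that the face d_jα (obtained by deleting v_j) is not critical. -/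
open scoped BigOperators Classical

namespace PathMorse

variable {V : Type} [Fintype V] [DecidableEq V]

theorem Allowed.edge_of_lt {V : Type} {G : Digraph V} (hG : G.Transitive) {n : ℕ} {p : Path V n}
    (hp : Allowed G p) {i j : Fin (n + 1)} (hij : i < j) : G.E (p i) (p j) := by
  have : IsTrans V G.E := ⟨hG⟩
  exact (Fin.liftFun_iff_succ G.E).2 hp hij

theorem Allowed.face {V : Type} {G : Digraph V} (hG : G.Transitive) {n : ℕ} {p : Path V (n + 1)}
    (hp : Allowed G p) (i : Fin (n + 2)) : Allowed G (face i p) := fun _ =>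
  hp.edge_of_lt hG (Fin.strictMono_succAbove i Fin.castSucc_lt_succ)

/-- A vertex joined by an edge, in either direction, to every vertex of an allowed path of a
transitive digraph can be inserted into that path. -/
theorem Allowed.exists_insertNth {V : Type} {G : Digraph V} (hG : G.Transitive) {n : ℕ}
    {p : Path V n} (hp : Allowed G p) {w : V} (hw : ∀ k, G.E (p k) w ∨ G.E w (p k)) :
    ∃ q : Fin (n + 2), Allowed G (n := n + 1) (q.insertNth (α := fun _ => V) w p) := by
  obtain ⟨q, hq, hmin⟩ := WellFounded.has_min (wellFounded_lt (α := Fin (n + 2)))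
    {q | ∀ i : Fin (n + 1), q ≤ i.castSucc → G.E w (p i)}
    ⟨Fin.last _, fun i hi => absurd (Fin.castSucc_lt_last i) (not_lt.2 hi)⟩
  have hlt : ∀ i : Fin (n + 1), i.castSucc < q → G.E (p i) w := by
    intro i hi
    refine (hw i).resolve_right fun h => hmin i.castSucc (fun j hj => ?_) hi
    rcases (Fin.castSucc_le_castSucc_iff.1 hj).eq_or_lt with rfl | hij
    · exact h
    · exact hG _ _ _ h (hp.edge_of_lt hG hij)
  refine ⟨q, fun k => ?_⟩
  have key : ∀ a b : Fin (n + 2), a < b →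
      G.E (q.insertNth (α := fun _ => V) w p a) (q.insertNth (α := fun _ => V) w p b) := by
    intro a b hab
    rcases Fin.eq_self_or_eq_succAbove q a with ha | ⟨i, rfl⟩ <;>
      rcases Fin.eq_self_or_eq_succAbove q b with hb | ⟨j, rfl⟩
    · exact absurd (ha.trans hb.symm) hab.ne
    · rw [ha] at hab ⊢
      rw [Fin.insertNth_apply_same, Fin.insertNth_apply_succAbove]
      exact hq j ((Fin.lt_succAbove_iff_le_castSucc _ _).1 hab)
    · rw [hb] at hab ⊢
      rw [Fin.insertNth_apply_same, Fin.insertNth_apply_succAbove]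
      exact hlt i ((Fin.succAbove_lt_iff_castSucc_lt _ _).1 hab)
    · rw [Fin.insertNth_apply_succAbove, Fin.insertNth_apply_succAbove]
      exact hp.edge_of_lt hG ((Fin.strictMono_succAbove q).lt_iff_lt.1 hab)
  exact key _ _ Fin.castSucc_lt_succ

theorem face_insertNth {V : Type} {n : ℕ} (q : Fin (n + 2)) (w : V) (p : Path V n) :
    face q (q.insertNth (α := fun _ => V) w p) = p :=
  funext fun k => Fin.insertNth_apply_succAbove (α := fun _ => V) q w p k

theorem fPath_eq_add_face {V : Type} (f : V → ℝ) {n : ℕ} (i : Fin (n + 2)) (p : Path V (n + 1)) :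
    fPath f p = f (p i) + fPath f (face i p) :=
  Fin.sum_univ_succAbove _ i

theorem fPath_insertNth {V : Type} {f : V → ℝ} {w : V} (hw : f w = 0) {n : ℕ} (q : Fin (n + 2))
    (p : Path V n) : fPath (n := n + 1) f (q.insertNth (α := fun _ => V) w p) = fPath f p := by
  rw [fPath_eq_add_face f q, face_insertNth, Fin.insertNth_apply_same, hw, zero_add]

theorem hasEqualCoface_iff {V : Type} {G : Digraph V} (hG : G.Transitive) (f : V → ℝ) {n : ℕ}
    {p : Path V n} (hp : Allowed G p) :
    HasEqualCoface G f p ↔ ∃ w, f w = 0 ∧ ∀ k, G.E (p k) w ∨ G.E w (p k) := by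
  constructor
  · rintro ⟨γ, hγ, ⟨i, rfl⟩, hfγ⟩
    rw [fPath_eq_add_face f i γ] at hfγ
    refine ⟨γ i, by linarith, fun k => ?_⟩
    rcases (Fin.succAbove_ne i k).lt_or_gt with h | h
    · exact Or.inl (hγ.edge_of_lt hG h)
    · exact Or.inr (hγ.edge_of_lt hG h)
  · rintro ⟨w, hw, hadj⟩
    obtain ⟨q, hq⟩ := hp.exists_insertNth hG hadj
    exact ⟨_, hq, ⟨q, face_insertNth q w p⟩, fPath_insertNth hw q p⟩

theorem hasEqualFace_iff {V : Type} {G : Digraph V} (hG : G.Transitive) (f : V → ℝ) {n : ℕ}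
    {p : Path V (n + 1)} (hp : Allowed G p) :
    HasEqualFace G f (n + 1) p ↔ ∃ k, f (p k) = 0 := by
  constructor
  · rintro ⟨β, -, ⟨k, rfl⟩, h⟩
    exact ⟨k, by linarith [fPath_eq_add_face f k p]⟩
  · rintro ⟨k, hk⟩
    exact ⟨face k p, hp.face hG k, ⟨k, rfl⟩, by linarith [fPath_eq_add_face f k p]⟩

/-- A vertex has at most one neighbour at which a discrete Morse function vanishes. -/
theorem IsMorse.eq_of_zero_of_adj {V : Type} {G : Digraph V} {f : V → ℝ} (hG : G.Transitive)
    (hf : IsMorse G f) {x w w' : V} (hw : f w = 0) (hw' : f w' = 0)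
    (hxw : G.E x w ∨ G.E w x) (hxw' : G.E x w' ∨ G.E w' x) : w = w' := by
  have hp : Allowed G (n := 0) fun _ => x := fun i => i.elim0
  obtain ⟨q, hq⟩ := hp.exists_insertNth hG fun _ => hxw
  obtain ⟨q', hq'⟩ := hp.exists_insertNth hG fun _ => hxw'
  have heq := congrFun (hf.2.1 0 _ hp _ _ hq hq' ⟨q, face_insertNth q w _⟩
    ⟨q', face_insertNth q' w' _⟩ (fPath_insertNth hw q _) (fPath_insertNth hw' q' _)) q
  rw [Fin.insertNth_apply_same] at heq
  rcases Fin.eq_self_or_eq_succAbove q' q with h | ⟨k, rfl⟩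
  · rwa [h, Fin.insertNth_apply_same] at heq
  · rw [Fin.insertNth_apply_succAbove] at heq
    subst heq
    exact absurd hxw (by simp [G.irrefl])

/-- A non-critical face of a critical path misses only the deleted vertex: some zero of `f` is
adjacent to all the remaining vertices. -/
theorem IsCritical.exists_zero_of_not_isCritical_face {V : Type} {G : Digraph V} {f : V → ℝ}
    (hG : G.Transitive) {n : ℕ} {p : Path V (n + 2)} (hp : IsCritical G f p) {i : Fin (n + 3)}
    (hi : ¬ IsCritical G f (face i p)) :
    ∃ w, f w = 0 ∧ ∀ k, k ≠ i → G.E (p k) w ∨ G.E w (p k) := by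
  have hface : ¬ HasEqualFace G f (n + 1) (face i p) := by
    rw [hasEqualFace_iff hG f (hp.1.face hG i)]
    rintro ⟨k, hk⟩
    exact hp.2.2 ((hasEqualFace_iff hG f hp.1).2 ⟨_, hk⟩)
  have hcoface : HasEqualCoface G f (face i p) :=
    not_not.1 fun h => hi ⟨hp.1.face hG i, h, hface⟩
  obtain ⟨w, hw, hadj⟩ := (hasEqualCoface_iff hG f (hp.1.face hG i)).1 hcoface
  refine ⟨w, hw, fun k hk => ?_⟩
  obtain ⟨l, rfl⟩ := Fin.exists_succAbove_eq hk
  exact hadj l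

/-- For a critical allowed elementary `n`-path (`n > 1`) on a transitive digraph,
at most one face `d_j α` fails to be critical. -/
theorem stmt7 {V : Type} [Fintype V] [DecidableEq V] (G : Digraph V) (f : V → ℝ)
    (hG : G.Transitive) (hf : IsMorse G f) (m : ℕ) (α : Path V (m+2))
    (hα : IsCritical G f α) :
    ∀ i j : Fin (m+3), ¬ IsCritical G f (face i α) → ¬ IsCritical G f (face j α) → i = j := by
  intro i j hi hj
  by_contra hij
  obtain ⟨w, hw, hadj⟩ := hα.exists_zero_of_not_isCritical_face hG hi
  obtain ⟨w', hw', hadj'⟩ := hα.exists_zero_of_not_isCritical_face hG hj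
  obtain ⟨k, hki, hkj⟩ : ∃ k, k ≠ i ∧ k ≠ j := by
    obtain ⟨k, -, hk⟩ := Finset.exists_mem_notMem_of_card_lt_card
      (s := {i, j}) (t := (Finset.univ : Finset (Fin (m + 3))))
      (by rw [Finset.card_fin]; exact Finset.card_le_two.trans_lt (by omega))
    exact ⟨k, by simpa using hk⟩
  obtain rfl : w = w' := hf.eq_of_zero_of_adj hG hw hw' (hadj k hki) (hadj' k hkj)
  refine hα.2.1 ((hasEqualCoface_iff hG f hα.1).2 ⟨w, hw, fun l => ?_⟩)
  by_cases hl : l = i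
  · exact hadj' l (hl ▸ hij)
  · exact hadj l hl

end PathMorse
end
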